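/- If G is a graph admitting a planar embedding whose outer cycle is Hamiltonian (G is a plane Hamiltonian graph), then G has book thickness at most 2; the edges inside the Hamiltonian cycle form one outerplanar (non-crossing) set and the edges outside form another, with respect to the vertex order given by the cycle. -/

import Mathlib

open SimpleGraph

/-- A book embedding of `G` on `p` pages with respect to the linear order on the vertices
given by the injection `ord : V ↪ ℕ`: a symmetric page assignment of the edges to pages
`0, …, p-1` such that no two edges on the same page cross. -/
def IsBookEmbedding {V : Type*} (G : SimpleGraph V) (p : ℕ)
    (ord : V ↪ ℕ) (page : V → V → ℕ) : Prop :=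
  (∀ a b, page a b = page b a) ∧
  (∀ a b, G.Adj a b → page a b < p) ∧
  (∀ a b c d, G.Adj a b → G.Adj c d → page a b = page c d →
    ¬ (ord a < ord c ∧ ord c < ord b ∧ ord b < ord d))

/-- The book thickness of `G`: the least number of pages over all book embeddings. -/
noncomputable def bookThickness {V : Type*} (G : SimpleGraph V) : ℕ :=
  sInf {p | ∃ ord page, IsBookEmbedding G p ord page}

/-- A straight-line plane drawing of a (finite simple) graph: vertices go to distinct points
of the plane and the closed segments representing distinct edges meet only at shared
endpoints.  By Fáry's theorem, a finite simple graph is planar iff it has such a drawing. -/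
def IsPlaneDrawing {V : Type*} (G : SimpleGraph V) (pos : V → ℝ × ℝ) : Prop :=
  Function.Injective pos ∧
  (∀ a b c d : V, G.Adj a b → G.Adj c d → a ≠ c → a ≠ d → b ≠ c → b ≠ d →
    segment ℝ (pos a) (pos b) ∩ segment ℝ (pos c) (pos d) = ∅) ∧
  (∀ a b c : V, G.Adj a b → G.Adj a c → b ≠ c →
    segment ℝ (pos a) (pos b) ∩ segment ℝ (pos a) (pos c) = {pos a}) ∧
  (∀ a b v : V, G.Adj a b → v ≠ a → v ≠ b → pos v ∉ segment ℝ (pos a) (pos b))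

/-- A graph is planar if it admits a plane (straight-line) drawing. -/
def IsPlanarG {V : Type*} (G : SimpleGraph V) : Prop :=
  ∃ pos : V → ℝ × ℝ, IsPlaneDrawing G pos

/-- A graph is outerplanar if it admits a plane drawing in which every vertex lies on the
outer face, i.e. every vertex point is an extreme point of the drawing (it is not in the
convex hull of the other vertex points). -/
def IsOuterplanarG {V : Type*} (G : SimpleGraph V) : Prop :=
  ∃ pos : V → ℝ × ℝ, IsPlaneDrawing G pos ∧
    ∀ v : V, pos v ∉ convexHull ℝ (pos '' {w | w ≠ v})

/-- The indicator, in `ZMod 2`, of `x` lying strictly between `a` and `b`. -/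
noncomputable def strictBtw (a x b : ℝ) : ZMod 2 :=
  if (a < x ∧ x < b) ∨ (b < x ∧ x < a) then 1 else 0

lemma strictBtw_comm (a x b : ℝ) : strictBtw a x b = strictBtw b x a := by
  simp only [strictBtw, or_comm]

lemma strictBtw_self_left (a b : ℝ) : strictBtw a a b = 0 := by simp [strictBtw]

lemma mem_uIcc_of_strictBtw_ne_zero {a x b : ℝ} (h : strictBtw a x b ≠ 0) :
    x ∈ Set.uIcc a b := by
  unfold strictBtw at h
  rw [Set.mem_uIcc]
  grind

lemma strictBtw_sum_eq_zero {p q r s : ℝ} (hpr : p ≠ r) (hps : p ≠ s) (hqr : q ≠ r)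
    (hqs : q ≠ s) :
    strictBtw r p s + strictBtw r q s + strictBtw p r q + strictBtw p s q = 0 := by
  have h2 : (1 + 1 : ZMod 2) = 0 := by decide
  unfold strictBtw
  grind

lemma strictBtw_same_side_sum {p x y z : ℝ} (hx : x ≠ p) (hy : y ≠ p) (hz : z ≠ p)
    (hxy : x ≠ y) (hxz : x ≠ z) (hyz : y ≠ z) :
    (strictBtw p x y + strictBtw p y x) + (strictBtw p x z + strictBtw p z x) +
      (strictBtw p y z + strictBtw p z y) = 1 := by
  have same (a b : ℝ) (ha : a ≠ p) (hb : b ≠ p) (hab : a ≠ b) :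
      strictBtw p a b + strictBtw p b a = if (a < p ↔ b < p) then 1 else 0 := by
    unfold strictBtw
    grind
  have h2 : (1 + 1 : ZMod 2) = 0 := by decide
  rw [same x y hx hy hxy, same x z hx hz hxz, same y z hy hz hyz]
  grind

/-- The height over `x` of the non-vertical line through `p` and `q`. -/
noncomputable def lineAt (p q : ℝ × ℝ) (x : ℝ) : ℝ :=
  p.2 + (x - p.1) / (q.1 - p.1) * (q.2 - p.2)

lemma lineAt_left (p q : ℝ × ℝ) : lineAt p q p.1 = p.2 := by simp [lineAt]

lemma lineAt_right {p q : ℝ × ℝ} (h : p.1 ≠ q.1) : lineAt p q q.1 = q.2 := by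
  simp [lineAt, div_self (sub_ne_zero.2 h.symm)]

lemma lineAt_comm {p q : ℝ × ℝ} (h : p.1 ≠ q.1) : lineAt p q = lineAt q p := by
  ext x
  have h₁ := sub_ne_zero.2 h
  have h₂ := sub_ne_zero.2 h.symm
  unfold lineAt
  field_simp
  ring

lemma mk_lineAt_mem_segment {p q : ℝ × ℝ} (h : p.1 ≠ q.1) {x : ℝ}
    (hx : x ∈ Set.uIcc p.1 q.1) : (x, lineAt p q x) ∈ segment ℝ p q := by
  have h₂ := sub_ne_zero.2 h.symm
  rw [segment_eq_image']
  refine ⟨(x - p.1) / (q.1 - p.1), ?_, ?_⟩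
  · rcases lt_or_gt_of_ne h with h | h
    · rw [Set.uIcc_of_le h.le] at hx
      exact ⟨div_nonneg (by linarith [hx.1]) (by linarith),
        (div_le_one (by linarith)).2 (by linarith [hx.2])⟩
    · rw [Set.uIcc_of_ge h.le] at hx
      exact ⟨div_nonneg_of_nonpos (by linarith [hx.2]) (by linarith),
        (div_le_one_of_neg (by linarith)).2 (by linarith [hx.1])⟩
  · ext
    · simp [div_mul_cancel₀ _ h₂]
    · simp [lineAt]

/-- The parity of the number of times the upward vertical ray from `r` meets the
segment `pq`. -/
noncomputable def rayUp (r p q : ℝ × ℝ) : ZMod 2 :=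
  strictBtw p.1 r.1 q.1 * if r.2 < lineAt p q r.1 then 1 else 0

/-- The parity of the number of times the downward vertical ray from `r` meets the
segment `pq`. -/
noncomputable def rayDown (r p q : ℝ × ℝ) : ZMod 2 :=
  strictBtw p.1 r.1 q.1 * if lineAt p q r.1 < r.2 then 1 else 0

lemma rayUp_comm (r : ℝ × ℝ) {p q : ℝ × ℝ} (h : p.1 ≠ q.1) : rayUp r p q = rayUp r q p := by
  rw [rayUp, rayUp, strictBtw_comm, lineAt_comm h]

lemma rayUp_self (p q : ℝ × ℝ) : rayUp p p q = 0 := by simp [rayUp, strictBtw_self_left]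

lemma rayDown_self (p q : ℝ × ℝ) : rayDown p p q = 0 := by simp [rayDown, strictBtw_self_left]

lemma rayDown_add_rayUp {r p q : ℝ × ℝ} (h : p.1 ≠ q.1) (hr : r ∉ segment ℝ p q) :
    rayDown r p q + rayUp r p q = strictBtw p.1 r.1 q.1 := by
  by_cases h0 : strictBtw p.1 r.1 q.1 = 0
  · simp [rayDown, rayUp, h0]
  have hne : r.2 ≠ lineAt p q r.1 := fun he ↦ hr <| by
    simpa [← he] using mk_lineAt_mem_segment h (mem_uIcc_of_strictBtw_ne_zero h0)
  rcases lt_or_gt_of_ne hne with h | h <;> simp [rayDown, rayUp, h, h.not_gt]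

/-- The parity of the number of common ends of the `x`-ranges of the segments `pq` and `rs` over
which `pq` runs strictly above `rs`. -/
noncomputable def aboveParity (p q r s : ℝ × ℝ) : ZMod 2 :=
  rayDown p r s + rayDown q r s + rayUp r p q + rayUp s p q

lemma aboveParity_eq_zero {p q r s : ℝ × ℝ} (hpq : p.1 ≠ q.1) (hrs : r.1 ≠ s.1)
    (hpr : p.1 ≠ r.1) (hps : p.1 ≠ s.1) (hqr : q.1 ≠ r.1) (hqs : q.1 ≠ s.1)
    (h : segment ℝ p q ∩ segment ℝ r s = ∅) : aboveParity p q r s = 0 := by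
  have cross : ∀ x ∈ Set.uIcc p.1 q.1 ∩ Set.uIcc r.1 s.1,
      ∀ y ∈ Set.uIcc p.1 q.1 ∩ Set.uIcc r.1 s.1,
      lineAt p q x ≤ lineAt r s x → lineAt p q y < lineAt r s y := by
    intro x hx y hy hxle
    by_contra! hyle
    have hcont : ContinuousOn (fun z ↦ lineAt p q z - lineAt r s z) (Set.uIcc x y) := by
      unfold lineAt
      fun_prop
    obtain ⟨z, hz, hz0⟩ := intermediate_value_uIcc hcont
      (Set.mem_uIcc_of_le (sub_nonpos.2 hxle) (sub_nonneg.2 hyle))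
    have h₁ := mk_lineAt_mem_segment hpq (Set.uIcc_subset_uIcc hx.1 hy.1 hz)
    have h₂ := mk_lineAt_mem_segment hrs (Set.uIcc_subset_uIcc hx.2 hy.2 hz)
    rw [sub_eq_zero.1 hz0] at h₁
    exact (h ▸ Set.mem_inter h₁ h₂ : _ ∈ (∅ : Set (ℝ × ℝ)))
  have hp := @mem_uIcc_of_strictBtw_ne_zero r.1 p.1 s.1
  have hq := @mem_uIcc_of_strictBtw_ne_zero r.1 q.1 s.1
  have hr := @mem_uIcc_of_strictBtw_ne_zero p.1 r.1 q.1
  have hs := @mem_uIcc_of_strictBtw_ne_zero p.1 s.1 q.1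
  have ep := lineAt_left p q
  have eq := lineAt_right hpq
  have er := lineAt_left r s
  have es := lineAt_right hrs
  by_cases hlow : ∃ x ∈ Set.uIcc p.1 q.1 ∩ Set.uIcc r.1 s.1, lineAt p q x ≤ lineAt r s x
  · obtain ⟨x, hx, hxle⟩ := hlow
    have low y hy := cross x hx y hy hxle
    have h1 : rayDown p r s = 0 := by
      by_contra h0
      have := low p.1 ⟨Set.left_mem_uIcc, hp (left_ne_zero_of_mul h0)⟩
      have := right_ne_zero_of_mul h0
      grind
    have h2 : rayDown q r s = 0 := by
      by_contra h0
      have := low q.1 ⟨Set.right_mem_uIcc, hq (left_ne_zero_of_mul h0)⟩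
      have := right_ne_zero_of_mul h0
      grind
    have h3 : rayUp r p q = 0 := by
      by_contra h0
      have := low r.1 ⟨hr (left_ne_zero_of_mul h0), Set.left_mem_uIcc⟩
      have := right_ne_zero_of_mul h0
      grind
    have h4 : rayUp s p q = 0 := by
      by_contra h0
      have := low s.1 ⟨hs (left_ne_zero_of_mul h0), Set.right_mem_uIcc⟩
      have := right_ne_zero_of_mul h0
      grind
    simp [aboveParity, h1, h2, h3, h4]
  · push Not at hlow
    have key (b : ZMod 2) (P : Prop) [Decidable P] (hP : b ≠ 0 → P) :
        b * (if P then 1 else 0) = b := by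
      by_cases hb : b = 0
      · simp [hb]
      · simp [hP hb]
    unfold aboveParity rayDown rayUp
    rw [key, key, key, key]
    · exact strictBtw_sum_eq_zero hpr hps hqr hqs
    · exact fun h0 ↦ by simpa [es] using hlow s.1 ⟨hs h0, Set.right_mem_uIcc⟩
    · exact fun h0 ↦ by simpa [er] using hlow r.1 ⟨hr h0, Set.left_mem_uIcc⟩
    · exact fun h0 ↦ by simpa [eq] using hlow q.1 ⟨Set.right_mem_uIcc, hq h0⟩
    · exact fun h0 ↦ by simpa [ep] using hlow p.1 ⟨Set.left_mem_uIcc, hp h0⟩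

lemma aboveParity_add_swap {p q s : ℝ × ℝ} (hq : q.1 ≠ p.1) (hs : s.1 ≠ p.1)
    (hqs : q ∉ segment ℝ p s) (hsq : s ∉ segment ℝ p q) :
    aboveParity p q p s + aboveParity p s p q = strictBtw p.1 q.1 s.1 + strictBtw p.1 s.1 q.1 := by
  rw [← rayDown_add_rayUp hs.symm hqs, ← rayDown_add_rayUp hq.symm hsq]
  simp only [aboveParity, rayUp_self, rayDown_self]
  ring

lemma aboveParity_swap_left {p q : ℝ × ℝ} (h : p.1 ≠ q.1) (r s : ℝ × ℝ) :
    aboveParity p q r s = aboveParity q p r s := by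
  simp only [aboveParity, rayUp_comm _ h]
  ring

lemma IsPlaneDrawing.comp {V : Type*} {G : SimpleGraph V} {pos : V → ℝ × ℝ}
    (h : IsPlaneDrawing G pos) (f : ℝ × ℝ →ₗ[ℝ] ℝ × ℝ) (hf : Function.Injective f) :
    IsPlaneDrawing G (f ∘ pos) := by
  obtain ⟨h1, h2, h3, h4⟩ := h
  have seg (a b : V) : segment ℝ ((f ∘ pos) a) ((f ∘ pos) b) = f '' segment ℝ (pos a) (pos b) :=
    (image_segment ℝ f.toAffineMap (pos a) (pos b)).symm
  refine ⟨hf.comp h1, ?_, ?_, ?_⟩ <;> simp only [seg, ← Set.image_inter hf]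
  · intro a b c d hab hcd hac had hbc hbd
    rw [h2 a b c d hab hcd hac had hbc hbd, Set.image_empty]
  · intro a b c hab hac hbc
    rw [h3 a b c hab hac hbc, Set.image_singleton, Function.comp_apply]
  · intro a b v hab hva hvb
    rw [Function.comp_apply, hf.mem_set_image]
    exact h4 a b v hab hva hvb

/-- A plane drawing of a finite graph can be sheared so that no two vertices share an
abscissa. -/
lemma IsPlanarG.exists_fst_injective {V : Type*} [Finite V] {G : SimpleGraph V}
    (h : IsPlanarG G) :
    ∃ pos : V → ℝ × ℝ, IsPlaneDrawing G pos ∧ Function.Injective fun v ↦ (pos v).1 := by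
  obtain ⟨pos, hpos⟩ := h
  have hfin : (Set.range fun e : V × V ↦
      -((pos e.1).1 - (pos e.2).1) / ((pos e.1).2 - (pos e.2).2)).Finite := Set.finite_range _
  obtain ⟨t, ht⟩ := hfin.infinite_compl.nonempty
  let f : ℝ × ℝ →ₗ[ℝ] ℝ × ℝ :=
    (LinearMap.fst ℝ ℝ ℝ + t • LinearMap.snd ℝ ℝ ℝ).prod (LinearMap.snd ℝ ℝ ℝ)
  have hf (x : ℝ × ℝ) : f x = (x.1 + t * x.2, x.2) := rfl
  refine ⟨f ∘ pos, hpos.comp f ?_, ?_⟩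
  · intro x y hxy
    simp only [hf, Prod.mk.injEq] at hxy
    obtain ⟨h1, h2⟩ := hxy
    rw [h2] at h1
    exact Prod.ext (add_right_cancel h1) h2
  · intro v w hvw
    simp only [Function.comp_apply, hf] at hvw
    apply hpos.1
    by_cases h2 : (pos v).2 = (pos w).2
    · rw [h2] at hvw
      exact Prod.ext (add_right_cancel hvw) h2
    · refine absurd ⟨(v, w), ?_⟩ ht
      have := sub_ne_zero.2 h2
      simp only
      field_simp
      linarith

/-- Summing over a path the numbers of edge overlap ends lying above `rs`. -/
lemma sum_Ico_aboveParity (g : ℕ → ℝ × ℝ) (r s : ℝ × ℝ) {a b : ℕ} (hab : a ≤ b) :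
    ∑ m ∈ Finset.Ico a b, aboveParity (g m) (g (m + 1)) r s =
      rayDown (g a) r s + rayDown (g b) r s +
        ∑ m ∈ Finset.Ico a b, rayUp r (g m) (g (m + 1)) +
        ∑ m ∈ Finset.Ico a b, rayUp s (g m) (g (m + 1)) := by
  induction b, hab using Nat.le_induction with
  | base => simp [CharTwo.add_self_eq_zero]
  | succ b hab ih =>
    rw [Finset.sum_Ico_succ_top hab, Finset.sum_Ico_succ_top hab, Finset.sum_Ico_succ_top hab, ih,
      aboveParity]
    linear_combination rayDown (g b) r s * (CharTwo.two_eq_zero (R := ZMod 2))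

/-- The parity of the number of times the upward vertical ray from `r` meets the closed polygon
consisting of the path `g a, …, g b` and the segment from `g b` to `g a`. -/
noncomputable def polyRay (g : ℕ → ℝ × ℝ) (a b : ℕ) (r : ℝ × ℝ) : ZMod 2 :=
  ∑ m ∈ Finset.Ico a b, rayUp r (g m) (g (m + 1)) + rayUp r (g b) (g a)

lemma polyRay_add_polyRay (g : ℕ → ℝ × ℝ) (r s : ℝ × ℝ) {a b : ℕ} (hab : a ≤ b) :
    polyRay g a b r + polyRay g a b s =
      ∑ m ∈ Finset.Ico a b, aboveParity (g m) (g (m + 1)) r s + aboveParity (g b) (g a) r s := by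
  rw [sum_Ico_aboveParity g r s hab]
  simp only [polyRay, aboveParity]
  linear_combination (-rayDown (g a) r s - rayDown (g b) r s) * (CharTwo.two_eq_zero (R := ZMod 2))

/-- The side of the closed polygon `g 0, …, g n = g 0` on which the segment from the vertex `g i`
to `s` starts, where `1 ≤ n`. -/
noncomputable def side (g : ℕ → ℝ × ℝ) (n i : ℕ) (s : ℝ × ℝ) : ZMod 2 :=
  ∑ m ∈ Finset.range n, rayUp (g i) (g m) (g (m + 1)) +
    aboveParity (g i) (g (i + 1)) (g i) s + aboveParity (g (i + n - 1)) (g (i + n)) (g i) s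

section Cycle

variable {V : Type*} {G : SimpleGraph V} {pos : V → ℝ × ℝ} {f : ℕ → V} {n : ℕ}

lemma IsPlaneDrawing.aboveParity_eq_zero (hpos : IsPlaneDrawing G pos)
    (hinj : Function.Injective fun v ↦ (pos v).1) {a b c d : V} (hab : G.Adj a b)
    (hcd : G.Adj c d) (hac : a ≠ c) (had : a ≠ d) (hbc : b ≠ c) (hbd : b ≠ d) :
    aboveParity (pos a) (pos b) (pos c) (pos d) = 0 :=
  _root_.aboveParity_eq_zero (hinj.ne hab.ne) (hinj.ne hcd.ne) (hinj.ne hac) (hinj.ne had)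
    (hinj.ne hbc) (hinj.ne hbd) (hpos.2.1 a b c d hab hcd hac had hbc hbd)

/-- Of three edges at a vertex, an odd number of pairs leave on the same side of the vertical
line. -/
lemma IsPlaneDrawing.aboveParity_star (hpos : IsPlaneDrawing G pos)
    (hinj : Function.Injective fun v ↦ (pos v).1) {p x y z : V} (hx : G.Adj p x)
    (hy : G.Adj p y) (hz : G.Adj p z) (hxy : x ≠ y) (hxz : x ≠ z) (hyz : y ≠ z) :
    (aboveParity (pos p) (pos x) (pos p) (pos y) + aboveParity (pos p) (pos y) (pos p) (pos x)) +
      (aboveParity (pos p) (pos x) (pos p) (pos z) + aboveParity (pos p) (pos z) (pos p) (pos x)) +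
      (aboveParity (pos p) (pos y) (pos p) (pos z) + aboveParity (pos p) (pos z) (pos p) (pos y))
      = 1 := by
  have pair {a b : V} (ha : G.Adj p a) (hb : G.Adj p b) (hab : a ≠ b) :=
    aboveParity_add_swap (hinj.ne ha.ne') (hinj.ne hb.ne')
      (hpos.2.2.2 p b a hb ha.ne' hab) (hpos.2.2.2 p a b ha hb.ne' hab.symm)
  rw [pair hx hy hxy, pair hx hz hxz, pair hy hz hyz]
  exact strictBtw_same_side_sum (hinj.ne hx.ne') (hinj.ne hy.ne') (hinj.ne hz.ne')
    (hinj.ne hxy) (hinj.ne hxz) (hinj.ne hyz)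

/-- Two chords of a plane cycle with alternating ends lie on different sides of it. -/
lemma IsPlaneDrawing.side_add_side (hpos : IsPlaneDrawing G pos)
    (hinj : Function.Injective fun v ↦ (pos v).1) (hf : Set.InjOn f (Set.Iio n))
    (hper : Function.Periodic f n) (hadj : ∀ m, G.Adj (f m) (f (m + 1))) {j k l : ℕ}
    (hk : 0 < k) (hkj : k < j) (hjl : j < l) (hln : l < n)
    (h₁ : G.Adj (f 0) (f j)) (h₂ : G.Adj (f k) (f l)) :
    side (pos ∘ f) n 0 (pos (f j)) + side (pos ∘ f) n k (pos (f l)) = 1 := by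
  obtain ⟨N, rfl⟩ : ∃ N, n = N + 1 := ⟨n - 1, by omega⟩
  obtain ⟨k, rfl⟩ : ∃ K, k = K + 1 := ⟨k - 1, by omega⟩
  have hn0 : f (N + 1) = f 0 := by simpa using hper 0
  have eq_of {a b : ℕ} (ha : a ≤ N + 1) (hb : b ≤ N + 1) (h : f a = f b) :
      a = b ∨ a = 0 ∧ b = N + 1 ∨ a = N + 1 ∧ b = 0 := by
    rcases ha.eq_or_lt with rfl | ha <;> rcases hb.eq_or_lt with rfl | hb
    · exact .inl rfl
    · exact .inr (.inr ⟨rfl, hf hb (by simp) (h.symm.trans hn0)⟩)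
    · exact .inr (.inl ⟨hf ha (by simp) (h.trans hn0), rfl⟩)
    · exact .inl (hf ha hb h)
  set g := pos ∘ f with hg
  have zero {a b c d : ℕ} (hab : G.Adj (f a) (f b)) (hcd : G.Adj (f c) (f d))
      (hle : a ≤ N + 1 ∧ b ≤ N + 1 ∧ c ≤ N + 1 ∧ d ≤ N + 1)
      (hne : a ≠ c ∧ a ≠ d ∧ b ≠ c ∧ b ≠ d)
      (hend : (a ≠ 0 ∧ b ≠ 0 ∨ c ≠ N + 1 ∧ d ≠ N + 1) ∧
        (a ≠ N + 1 ∧ b ≠ N + 1 ∨ c ≠ 0 ∧ d ≠ 0)) :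
      aboveParity (g a) (g b) (g c) (g d) = 0 :=
    hpos.aboveParity_eq_zero hinj hab hcd
      (fun h ↦ by have := eq_of (by omega) (by omega) h; omega)
      (fun h ↦ by have := eq_of (by omega) (by omega) h; omega)
      (fun h ↦ by have := eq_of (by omega) (by omega) h; omega)
      (fun h ↦ by have := eq_of (by omega) (by omega) h; omega)
  have adjN : G.Adj (f 0) (f N) := hn0 ▸ (hadj N).symm
  -- The two closed polygons formed by the chord `f 0 f j` and an arc of the cycle.
  let A := polyRay g 0 j
  let B := polyRay g j (N + 1)
  have hA r s : A r + A s = ∑ m ∈ Finset.Ico 0 j, aboveParity (g m) (g (m + 1)) r s +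
      aboveParity (g j) (g 0) r s := polyRay_add_polyRay g r s (by omega)
  have hB r s : B r + B s = ∑ m ∈ Finset.Ico j (N + 1), aboveParity (g m) (g (m + 1)) r s +
      aboveParity (g (N + 1)) (g j) r s := polyRay_add_polyRay g r s (by omega)
  have hgn : g (N + 1) = g 0 := congrArg pos hn0
  have hne_j : (g 0).1 ≠ (g j).1 := hinj.ne h₁.ne
  have hne_N : (g 0).1 ≠ (g N).1 := hinj.ne adjN.ne
  have hC r : ∑ m ∈ Finset.range (N + 1), rayUp r (g m) (g (m + 1)) = A r + B r := by
    rw [Finset.range_eq_Ico, ← Finset.sum_Ico_consecutive _ (Nat.zero_le j) (by omega)]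
    simp only [A, B, polyRay]
    rw [hgn, rayUp_comm r hne_j]
    linear_combination (-rayUp r (g j) (g 0)) * (CharTwo.two_eq_zero (R := ZMod 2))
  have constB : ∀ i, 1 ≤ i → i < j → B (g i) = B (g 1) := by
    intro i hi
    induction i, hi using Nat.le_induction with
    | base => simp
    | succ i hi ih =>
      intro hij
      rw [← ih (by omega), ← CharTwo.add_eq_zero, hB, Finset.sum_eq_zero, zero_add]
      · exact zero (hn0 ▸ h₁) (hadj i).symm (by omega) (by omega) (by omega)
      · intro m hm
        rw [Finset.mem_Ico] at hm
        exact zero (hadj m) (hadj i).symm (by omega) (by omega) (by omega)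
  have constA : ∀ i, j + 1 ≤ i → i < N + 1 → A (g i) = A (g (j + 1)) := by
    intro i hi
    induction i, hi using Nat.le_induction with
    | base => simp
    | succ i hi ih =>
      intro hin
      rw [← ih (by omega), ← CharTwo.add_eq_zero, hA, Finset.sum_eq_zero, zero_add]
      · exact zero h₁.symm (hadj i).symm (by omega) (by omega) (by omega)
      · intro m hm
        rw [Finset.mem_Ico] at hm
        exact zero (hadj m) (hadj i).symm (by omega) (by omega) (by omega)
  have hAkl : A (g (k + 1)) + A (g l) = aboveParity (g k) (g (k + 1)) (g (k + 1)) (g l) +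
      aboveParity (g (k + 1)) (g (k + 2)) (g (k + 1)) (g l) := by
    rw [hA, zero h₁.symm h₂ (by omega) (by omega) (by omega), add_zero]
    refine Finset.sum_eq_add k (k + 1) (by omega) (fun m hm hmk ↦ ?_) (fun h ↦ ?_) (fun h ↦ ?_)
    · rw [Finset.mem_Ico] at hm
      exact zero (hadj m) h₂ (by omega) (by omega) (by omega)
    · exact absurd (Finset.mem_Ico.2 (by omega)) h
    · exact absurd (Finset.mem_Ico.2 (by omega)) h
  have hB01 : B (g 0) + B (g 1) = aboveParity (g 0) (g N) (g 0) (g 1) +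
      aboveParity (g 0) (g j) (g 0) (g 1) := by
    rw [hB, hgn, aboveParity_swap_left hne_N, ← hgn]
    refine congrArg (· + _) (Finset.sum_eq_single N (fun m hm hmN ↦ ?_) (fun h ↦ ?_))
    · rw [Finset.mem_Ico] at hm
      rw [hgn]
      exact zero (hadj m) (hadj 0) (by omega) (by omega) (by omega)
    · exact absurd (Finset.mem_Ico.2 (by omega)) h
  have hA0N : A (g 0) + A (g N) = aboveParity (g 0) (g 1) (g 0) (g N) +
      aboveParity (g 0) (g j) (g 0) (g N) := by
    rw [hA, aboveParity_swap_left hne_j]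
    refine congrArg (· + _) (Finset.sum_eq_single 0 (fun m hm hm0 ↦ ?_) (fun h ↦ ?_))
    · rw [Finset.mem_Ico] at hm
      rw [← hgn]
      exact zero (hadj m) (hadj N).symm (by omega) (by omega) (by omega)
    · exact absurd (Finset.mem_Ico.2 (by omega)) h
  have hBk := constB (k + 1) (by omega) hkj
  have hAl := (constA l hjl hln).trans (constA N (by omega) (by omega)).symm
  have star : _ = (1 : ZMod 2) := hpos.aboveParity_star hinj (hadj 0) adjN h₁
    (fun h ↦ by have := eq_of (by omega) (by omega) h; omega)
    (fun h ↦ by have := eq_of (by omega) (by omega) h; omega)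
    (fun h ↦ by have := eq_of (by omega) (by omega) h; omega)
  have hs0 : side g (N + 1) 0 (pos (f j)) = A (g 0) + B (g 0) +
      aboveParity (g 0) (g 1) (g 0) (g j) + aboveParity (g 0) (g N) (g 0) (g j) := by
    rw [side, hC, Nat.zero_add, Nat.zero_add, Nat.add_sub_cancel, hgn,
      aboveParity_swap_left hne_N]
    rfl
  have hsk : side g (N + 1) (k + 1) (pos (f l)) = A (g (k + 1)) + B (g (k + 1)) +
      aboveParity (g (k + 1)) (g (k + 2)) (g (k + 1)) (g l) +
      aboveParity (g k) (g (k + 1)) (g (k + 1)) (g l) := by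
    have e1 : g (k + 1 + (N + 1) - 1) = g k := by
      rw [show k + 1 + (N + 1) - 1 = k + (N + 1) by omega]
      exact congrArg pos (hper k)
    have e2 : g (k + 1 + (N + 1)) = g (k + 1) := congrArg pos (hper (k + 1))
    rw [side, hC, e1, e2]
    rfl
  rw [hs0, hsk]
  change aboveParity (g 0) (g 1) (g 0) (g N) + aboveParity (g 0) (g N) (g 0) (g 1) +
    (aboveParity (g 0) (g 1) (g 0) (g j) + aboveParity (g 0) (g j) (g 0) (g 1)) +
    (aboveParity (g 0) (g N) (g 0) (g j) + aboveParity (g 0) (g j) (g 0) (g N)) = 1 at star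
  rw [hAl] at hAkl
  have h2 : (2 : ZMod 2) = 0 := CharTwo.two_eq_zero
  linear_combination star + hAkl + hBk + hB01 + hA0N + h2 *
    (aboveParity (g (k + 1)) (g (k + 2)) (g (k + 1)) (g l) +
      aboveParity (g k) (g (k + 1)) (g (k + 1)) (g l) - A (g N))

end Cycle

lemma side_comp_add {g : ℕ → ℝ × ℝ} {n : ℕ} (hg : Function.Periodic g n) (i k : ℕ)
    (hn : 0 < n) (s : ℝ × ℝ) : side (fun m ↦ g (m + i)) n k s = side g n (k + i) s := by
  have sum_shift (F : ℕ → ZMod 2) (hF : Function.Periodic F n) :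
      ∑ m ∈ Finset.range n, F (m + i) = ∑ m ∈ Finset.range n, F m := by
    induction i with
    | zero => simp
    | succ i ih =>
      rw [← ih]
      have h := Finset.sum_range_succ' (fun m ↦ F (m + i)) n
      rw [Finset.sum_range_succ, show n + i = i + n by omega, hF, Nat.zero_add] at h
      simpa [add_right_comm _ 1 i, add_assoc] using (add_right_cancel h).symm
  have hsum := sum_shift (fun m ↦ rayUp (g (k + i)) (g m) (g (m + 1))) fun m ↦ by
    simp only [add_right_comm m n 1, hg _]
  unfold side
  simp only [add_right_comm _ 1 i, ← hsum, show k + n - 1 + i = k + i + n - 1 by omega,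
    add_right_comm k n i]

lemma SimpleGraph.Walk.IsHamiltonianCycle.exists_periodic {V : Type*} [DecidableEq V]
    {G : SimpleGraph V} {a : V} {p : G.Walk a a} (hp : p.IsHamiltonianCycle) :
    ∃ f : ℕ → V, Function.Periodic f p.length ∧ Set.InjOn f (Set.Iio p.length) ∧
      (∀ m, G.Adj (f m) (f (m + 1))) ∧ ∀ v, ∃ i < p.length, f i = v := by
  have hpos : 0 < p.length := by have := hp.isCycle.three_le_length; omega
  refine ⟨fun m ↦ p.getVert (m % p.length), fun m ↦ by simp, fun i hi j hj h ↦ ?_,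
    fun m ↦ ?_, fun v ↦ ?_⟩
  · simp only [Set.mem_Iio] at hi hj
    simp only [Nat.mod_eq_of_lt hi, Nat.mod_eq_of_lt hj] at h
    exact hp.isCycle.getVert_injOn' (by simp only [Set.mem_ofPred_eq]; omega)
      (by simp only [Set.mem_ofPred_eq]; omega) h
  · have hlt := Nat.mod_lt m hpos
    have hadj := p.adj_getVert_succ hlt
    rcases (Nat.succ_le_of_lt hlt).eq_or_lt with h | h
    · have h0 : (m + 1) % p.length = 0 := by
        rw [← Nat.mod_add_mod, ← Nat.succ_eq_add_one, h, Nat.mod_self]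
      rw [← Nat.succ_eq_add_one, h, p.getVert_length] at hadj
      simpa [h0] using hadj
    · have h0 : (m + 1) % p.length = m % p.length + 1 := by
        rw [← Nat.mod_add_mod, Nat.mod_eq_of_lt h]
      simpa [h0] using hadj
  · obtain ⟨i, rfl, hi⟩ := SimpleGraph.Walk.mem_support_iff_exists_getVert.1 (hp.mem_support v)
    rcases hi.eq_or_lt with rfl | hi
    · exact ⟨0, hpos, by simp⟩
    · exact ⟨i, hi, by simp [Nat.mod_eq_of_lt hi]⟩

lemma bookThickness_le {V : Type*} {G : SimpleGraph V} {p : ℕ} {ord : V ↪ ℕ} {page : V → V → ℕ}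
    (h : IsBookEmbedding G p ord page) : bookThickness G ≤ p :=
  Nat.sInf_le ⟨ord, page, h⟩

/-- A planar Hamiltonian graph has book thickness at most `2`. -/
theorem bookThickness_le_two_of_planar_hamiltonian {V : Type*} [Fintype V] [DecidableEq V]
    (G : SimpleGraph V) (hp : IsPlanarG G) (hh : G.IsHamiltonian) :
    bookThickness G ≤ 2 := by
  by_cases hcard : Fintype.card V = 1
  · have : Subsingleton V := Fintype.card_le_one_iff_subsingleton.1 hcard.le
    have hG (a b : V) : ¬ G.Adj a b := fun h ↦ h.ne (Subsingleton.elim a b)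
    exact bookThickness_le (ord := (Fintype.equivFin V).toEmbedding.trans Fin.valEmbedding)
      (page := fun _ _ ↦ 0)
      ⟨fun _ _ ↦ rfl, fun a b h ↦ (hG a b h).elim, fun a b _ _ h ↦ (hG a b h).elim⟩
  obtain ⟨v, p, hcyc⟩ := hh hcard
  obtain ⟨pos, hpos, hinj⟩ := hp.exists_fst_injective
  obtain ⟨f, hper, hf, hadj, hsurj⟩ := hcyc.exists_periodic
  choose idx hlt hidx using hsurj
  set n := p.length
  let ord : V ↪ ℕ := ⟨idx, Function.LeftInverse.injective hidx⟩
  let page (a b : V) : ℕ := (if idx a < idx b then side (pos ∘ f) n (idx a) (pos b)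
    else side (pos ∘ f) n (idx b) (pos a)).val
  refine bookThickness_le (ord := ord) (page := page) ⟨fun a b ↦ ?_, fun a b _ ↦ ZMod.val_lt _, ?_⟩
  · rcases lt_trichotomy (idx a) (idx b) with h | h | h
    · simp only [page, h, h.not_gt, if_true, if_false]
    · rw [ord.injective h]
    · simp only [page, h, h.not_gt, if_true, if_false]
  · rintro a b c d hab hcd hpage ⟨hac, hcb, hbd⟩
    change idx a < idx c at hac
    change idx c < idx b at hcb
    change idx b < idx d at hbd
    simp only [page, hac.trans hcb, hcb.trans hbd, if_true] at hpage
    have hsides := ZMod.val_injective 2 hpage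
    have hld := hlt d
    -- Rotate the cycle so that it starts at `a`.
    have hper' : Function.Periodic (fun m ↦ f (m + idx a)) n := fun m ↦ by
      simp only [add_right_comm m n, hper _]
    have hinj' : Set.InjOn (fun m ↦ f (m + idx a)) (Set.Iio n) := by
      intro i hi j hj hij
      have hn : 0 < n := by omega
      simp only [← hper.map_mod_nat (_ + idx a)] at hij
      have hmod : i ≡ j [MOD n] := Nat.ModEq.add_right_cancel' (idx a)
        (hf (Nat.mod_lt _ hn) (Nat.mod_lt _ hn) hij)
      exact hmod.eq_of_lt_of_lt hi hj
    have shift {w : V} (h : idx a < idx w) : f (idx w - idx a + idx a) = w := by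
      rw [Nat.sub_add_cancel h.le, hidx]
    have key := hpos.side_add_side (f := fun m ↦ f (m + idx a)) hinj hinj' hper'
      (fun m ↦ by simpa only [add_right_comm] using hadj (m + idx a))
      (j := idx b - idx a) (k := idx c - idx a) (l := idx d - idx a)
      (by omega) (by omega) (by omega) (by omega)
      (by simpa only [Nat.zero_add, shift (hac.trans hcb), hidx] using hab)
      (by simpa only [shift hac, shift (hac.trans (hcb.trans hbd))] using hcd)
    have hgper : Function.Periodic (pos ∘ f) n := fun m ↦ congrArg pos (hper m)
    change side (fun m ↦ (pos ∘ f) (m + idx a)) n 0 _ +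
      side (fun m ↦ (pos ∘ f) (m + idx a)) n (idx c - idx a) _ = 1 at key
    rw [side_comp_add hgper _ _ (by omega), side_comp_add hgper _ _ (by omega), Nat.zero_add,
      shift (hac.trans hcb), shift (hac.trans (hcb.trans hbd)), Nat.sub_add_cancel hac.le,
      hsides, CharTwo.add_self_eq_zero] at key
    exact zero_ne_one key
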